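/- arXiv:2511.01157 — 5 statements merged into one kernel-verified Lean document; each statement's English description precedes it below -/
import Mathlib

section
/- Let β ∈ [0,1], let Ω be an allocation problem with product value structure, and let (x,p) be a truthful mechanism for Ω. If the allocation algorithm x is a β-approximation for static investment, then x is a β-approximation for dynamic investment: for every dynamic investment instance ω̃^T and every online learning algorithm ℒ, the expected welfare satisfies W̃_x(ω̃^T,ℒ) ≥ β·W̃*(ω̃^T) − Reg(ω̃^T,ℒ). -/
open Finset

section InvestmentFramework

variable {N O S ix : Type} [Fintype N] [Fintype O] [Fintype S] [DecidableEq N]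

/-- The welfare `Σ_n v_n · a_n` of an allocation `a : N → O` under value profile `v`,
where each outcome is identified with its indicator vector in `ℝ^O`. -/
def allocWelfare {N O : Type} [Fintype N] (v : N → O → ℝ) (a : N → O) : ℝ :=
  ∑ n, v n (a n)

/-- The optimal welfare `W*(v,A) = max_{a ∈ A} Σ_n v_n · a_n` of an allocation instance. -/
noncomputable def Wstar {N O : Type} [Fintype N] (v : N → O → ℝ) (A : Set (N → O)) : ℝ :=
  sSup ((fun a => allocWelfare v a) '' A)

/-- `Ω` is an allocation problem: every allocation instance `(v,A) ∈ Ω` has a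
nonnegative value profile and a nonempty feasible set. -/
def IsAllocProblem {N O : Type} (Ω : Set ((N → O → ℝ) × Set (N → O))) : Prop :=
  ∀ vA ∈ Ω, (∀ n o, 0 ≤ vA.1 n o) ∧ vA.2.Nonempty

/-- `x` is an allocation algorithm for `Ω`: it maps every instance of `Ω` to a
feasible allocation. -/
def IsAllocAlg {N O : Type} (Ω : Set ((N → O → ℝ) × Set (N → O)))
    (x : (N → O → ℝ) → Set (N → O) → (N → O)) : Prop :=
  ∀ v A, (v, A) ∈ Ω → x v A ∈ A

/-- The welfare `W_x(v,A)` of the allocation chosen by algorithm `x`. -/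
def WelfareOf {N O : Type} [Fintype N] (x : (N → O → ℝ) → Set (N → O) → (N → O))
    (v : N → O → ℝ) (A : Set (N → O)) : ℝ :=
  allocWelfare v (x v A)

/-- Product value structure: the value profiles of `Ω` range over the product set
`∏_{n,o} V n o`; in particular every instance has values in `V` and unilateral
replacement of one bidder's value by any admissible value stays in `Ω`. -/
def ProductStructure (Ω : Set ((N → O → ℝ) × Set (N → O))) (V : N → O → Set ℝ) : Prop :=
  (∀ v A, (v, A) ∈ Ω → ∀ n o, v n o ∈ V n o) ∧
  (∀ v A n (w : O → ℝ), (v, A) ∈ Ω → (∀ o, w o ∈ V n o) →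
    (Function.update v n w, A) ∈ Ω)

/-- Truthfulness of the mechanism `(x, p)`: no bidder can gain by misreporting an
admissible value. -/
def Truthful (Ω : Set ((N → O → ℝ) × Set (N → O))) (V : N → O → Set ℝ)
    (x : (N → O → ℝ) → Set (N → O) → (N → O))
    (p : (N → O → ℝ) → Set (N → O) → N → ℝ) : Prop :=
  ∀ v A n (w : O → ℝ), (v, A) ∈ Ω → (∀ o, w o ∈ V n o) →
    v n (x v A n) - p v A n ≥
      v n (x (Function.update v n w) A n) - p (Function.update v n w) A n

/-- Weak monotonicity: `(v'_n − v_n) · (x_n(v'_n,v_{−n},A) − x_n(v,A)) ≥ 0`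
(outcomes identified with indicator vectors). -/
def WeaklyMonotone (Ω : Set ((N → O → ℝ) × Set (N → O))) (V : N → O → Set ℝ)
    (x : (N → O → ℝ) → Set (N → O) → (N → O)) : Prop :=
  ∀ v A n (w : O → ℝ), (v, A) ∈ Ω → (∀ o, w o ∈ V n o) →
    (w (x (Function.update v n w) A n) - v n (x (Function.update v n w) A n)) -
      (w (x v A n) - v n (x v A n)) ≥ 0

/-- A change from value `vn` to `w` confirms outcome `o'` if
`(w − vn)·(o' − o) ≥ 0` for every outcome `o`. -/
def Confirms {O : Type} (vn w : O → ℝ) (o' : O) : Prop :=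
  ∀ o : O, (w o' - vn o') - (w o - vn o) ≥ 0

/-- `x` excludes confirming negative externalities (XCONE). -/
def XCONE (Ω : Set ((N → O → ℝ) × Set (N → O))) (V : N → O → Set ℝ)
    (x : (N → O → ℝ) → Set (N → O) → (N → O)) : Prop :=
  ∀ v A n (w : O → ℝ), (v, A) ∈ Ω → (∀ o, w o ∈ V n o) →
    Confirms (v n) w (x v A n) →
    0 ≤ ∑ m, (v m (x (Function.update v n w) A m) - v m (x v A m))

/-- `x` is a β-approximation for allocation. -/
def ApproxAlloc {N O : Type} [Fintype N] (β : ℝ) (Ω : Set ((N → O → ℝ) × Set (N → O)))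
    (x : (N → O → ℝ) → Set (N → O) → (N → O)) : Prop :=
  ∀ v A, (v, A) ∈ Ω → WelfareOf x v A ≥ β * Wstar v A

/-- A static investment instance `ω̄ = (g, I, ν_{−ι}, 𝒜)`: a state distribution `g`,
a finite set of investments indexed by `ix` (each an investment value map together
with a cost), the other bidders' values, and the feasible allocation sets. -/
structure StaticInstance (N O S ix : Type) where
  /-- state distribution -/
  g : S → ℝ
  /-- the investments `(ν_ι, c)` -/
  inv : ix → (S → O → ℝ) × ℝ
  /-- the other bidders' values (the coordinate at the investor is overridden) -/
  vother : S → N → O → ℝ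
  /-- feasible allocation sets -/
  feas : S → Set (N → O)

/-- The full reported value profile `ν(s)` when investor `ι` chooses investment `i`. -/
def profOf (ι : N) (w : StaticInstance N O S ix) (i : ix) (s : S) : N → O → ℝ :=
  Function.update (w.vother s) ι ((w.inv i).1 s)

/-- Validity of a static investment instance: `g` is a probability distribution on `S`
and every induced allocation instance belongs to `Ω`. -/
def StaticValid (Ω : Set ((N → O → ℝ) × Set (N → O))) (ι : N)
    (w : StaticInstance N O S ix) : Prop :=
  (∀ s, 0 ≤ w.g s) ∧ (∑ s, w.g s = 1) ∧
  (∀ (i : ix) (s : S), (profOf ι w i s, w.feas s) ∈ Ω)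

/-- The investor's utility `u(ω̄,s,ν_ι,c)` at state `s` under investment `i`. -/
def utilAt (x : (N → O → ℝ) → Set (N → O) → (N → O))
    (p : (N → O → ℝ) → Set (N → O) → N → ℝ)
    (ι : N) (w : StaticInstance N O S ix) (i : ix) (s : S) : ℝ :=
  (w.inv i).1 s (x (profOf ι w i s) (w.feas s) ι) -
    p (profOf ι w i s) (w.feas s) ι - (w.inv i).2

/-- The welfare `W̄_x(ω̄,s,ν_ι,c)` achieved by algorithm `x` at state `s`. -/
def welAt (x : (N → O → ℝ) → Set (N → O) → (N → O))
    (ι : N) (w : StaticInstance N O S ix) (i : ix) (s : S) : ℝ :=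
  WelfareOf x (profOf ι w i s) (w.feas s) - (w.inv i).2

/-- The optimal welfare `W̄*(ω̄,s,ν_ι,c)` at state `s`. -/
noncomputable def welOptAt (ι : N) (w : StaticInstance N O S ix) (i : ix) (s : S) : ℝ :=
  Wstar (profOf ι w i s) (w.feas s) - (w.inv i).2

/-- The expected utility `u(ω̄,ν_ι,c)` of the investor. -/
def expUtil (x : (N → O → ℝ) → Set (N → O) → (N → O))
    (p : (N → O → ℝ) → Set (N → O) → N → ℝ)
    (ι : N) (w : StaticInstance N O S ix) (i : ix) : ℝ :=
  ∑ s, w.g s * utilAt x p ι w i s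

/-- The expected welfare `W̄_x(ω̄,ν_ι,c)` of algorithm `x`. -/
def expWel (x : (N → O → ℝ) → Set (N → O) → (N → O))
    (ι : N) (w : StaticInstance N O S ix) (i : ix) : ℝ :=
  ∑ s, w.g s * welAt x ι w i s

/-- The expected optimal welfare `W̄*(ω̄,ν_ι,c)`. -/
noncomputable def expWelOpt (ι : N) (w : StaticInstance N O S ix) (i : ix) : ℝ :=
  ∑ s, w.g s * welOptAt ι w i s

/-- The set `BR(ω̄)` of best-response investments. -/
def BRset (x : (N → O → ℝ) → Set (N → O) → (N → O))
    (p : (N → O → ℝ) → Set (N → O) → N → ℝ)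
    (ι : N) (w : StaticInstance N O S ix) : Set ix :=
  {i | ∀ j, expUtil x p ι w j ≤ expUtil x p ι w i}

/-- `x` is a β-approximation for static investment:
`min_{BR(ω̄)} W̄_x(ω̄,·) ≥ β · max_{I} W̄*(ω̄,·)` for every static investment instance. -/
def ApproxStaticInv (β : ℝ) (Ω : Set ((N → O → ℝ) × Set (N → O))) (ι : N)
    (x : (N → O → ℝ) → Set (N → O) → (N → O))
    (p : (N → O → ℝ) → Set (N → O) → N → ℝ) : Prop :=
  ∀ (jx : Type) [Fintype jx] [Nonempty jx] (w : StaticInstance N O S jx),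
    StaticValid Ω ι w →
    ∀ i ∈ BRset x p ι w,
      expWel x ι w i ≥
        β * (Finset.univ.sup' Finset.univ_nonempty fun j => expWelOpt ι w j)

/-- A dynamic investment instance `ω̃^T`: a horizon `T`, a common investment set
(indexed by `ix`), and for each round a state distribution, the other bidders'
values, and the feasible allocation sets. -/
structure DynInstance (N O S ix : Type) where
  /-- number of rounds -/
  T : ℕ
  /-- the common set of investments -/
  inv : ix → (S → O → ℝ) × ℝ
  /-- per-round state distributions -/
  g : Fin T → S → ℝ
  /-- per-round values of the other bidders -/
  vother : Fin T → S → N → O → ℝ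
  /-- per-round feasible allocation sets -/
  feas : Fin T → S → Set (N → O)

/-- The static investment instance `ω̄^(t)` of round `t`. -/
def DynInstance.round {N O S ix : Type} (D : DynInstance N O S ix) (t : Fin D.T) :
    StaticInstance N O S ix :=
  ⟨D.g t, D.inv, D.vother t, D.feas t⟩

/-- Validity of a dynamic investment instance w.r.t. `Ω`. -/
def DynValid (Ω : Set ((N → O → ℝ) × Set (N → O))) (ι : N)
    (D : DynInstance N O S ix) : Prop :=
  ∀ t : Fin D.T, StaticValid Ω ι (D.round t)

/-- An online learning algorithm: given the history of (chosen investment, realized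
utility) pairs of the previous rounds — i.e. it only uses bandit feedback and its
own internal randomness — it outputs a probability distribution over investments. -/
def IsLearningAlg {ix : Type} [Fintype ix] (L : List (ix × ℝ) → ix → ℝ) : Prop :=
  ∀ h : List (ix × ℝ), (∀ i, 0 ≤ L h i) ∧ (∑ i, L h i = 1)

variable [Fintype ix]

/-- Expectation, over the trajectory of the interaction (states drawn from the
per-round distributions, investments drawn from the learning algorithm applied to
the realized utility history), of a function `F` of the trajectory. -/
noncomputable def trajExp (x : (N → O → ℝ) → Set (N → O) → (N → O))
    (p : (N → O → ℝ) → Set (N → O) → N → ℝ) (ι : N) (D : DynInstance N O S ix)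
    (L : List (ix × ℝ) → ix → ℝ) :
    List (Fin D.T) → List (ix × ℝ) → (List (ix × S) → ℝ) → ℝ
  | [], _, F => F []
  | t :: ts, h, F =>
      ∑ i, ∑ s, L h i * D.g t s *
        trajExp x p ι D L ts (h ++ [(i, utilAt x p ι (D.round t) i s)])
          (fun tr => F ((i, s) :: tr))

/-- The expected welfare `W̃_x(ω̃^T, ℒ)` of algorithm `x` when the investor uses the
online learning algorithm `L`. -/
noncomputable def dynWelfare (x : (N → O → ℝ) → Set (N → O) → (N → O))
    (p : (N → O → ℝ) → Set (N → O) → N → ℝ) (ι : N) (D : DynInstance N O S ix)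
    (L : List (ix × ℝ) → ix → ℝ) : ℝ :=
  trajExp x p ι D L (List.finRange D.T) []
    (fun tr => (List.zipWith (fun t (q : ix × S) => welAt x ι (D.round t) q.1 q.2)
        (List.finRange D.T) tr).sum)

variable [Nonempty ix]

/-- The expected regret `Reg(ω̃^T, ℒ)` of the online learning algorithm `L`. -/
noncomputable def dynRegret (x : (N → O → ℝ) → Set (N → O) → (N → O))
    (p : (N → O → ℝ) → Set (N → O) → N → ℝ) (ι : N) (D : DynInstance N O S ix)
    (L : List (ix × ℝ) → ix → ℝ) : ℝ :=
  trajExp x p ι D L (List.finRange D.T) []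
    (fun tr =>
      (Finset.univ.sup' Finset.univ_nonempty fun i : ix =>
          (List.zipWith (fun t (q : ix × S) => utilAt x p ι (D.round t) i q.2)
            (List.finRange D.T) tr).sum) -
        (List.zipWith (fun t (q : ix × S) => utilAt x p ι (D.round t) q.1 q.2)
          (List.finRange D.T) tr).sum)

/-- The optimal expected welfare `W̃*(ω̃^T) = max_{(ν_ι,c) ∈ I} Σ_t W̄*(ω̄^(t),ν_ι,c)`
(best-in-hindsight fixed investment benchmark). -/
noncomputable def dynOptWelfare (ι : N) (D : DynInstance N O S ix) : ℝ :=
  Finset.univ.sup' Finset.univ_nonempty fun i : ix => ∑ t, expWelOpt ι (D.round t) i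

/-- The strongly dynamic welfare `W̃*_dyn(ω̃^T) = Σ_t max_{(ν_ι,c) ∈ I} W̄*(ω̄^(t),ν_ι,c)`
(time-varying benchmark). -/
noncomputable def strongDynOptWelfare (ι : N) (D : DynInstance N O S ix) : ℝ :=
  ∑ t, Finset.univ.sup' Finset.univ_nonempty fun i : ix => expWelOpt ι (D.round t) i

/-- `x` is a β-approximation for dynamic investment:
`W̃_x(ω̃^T,ℒ) ≥ β·W̃*(ω̃^T) − Reg(ω̃^T,ℒ)` for every dynamic investment instance and
every online learning algorithm. -/
def ApproxDynInv (β : ℝ) (Ω : Set ((N → O → ℝ) × Set (N → O))) (ι : N)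
    (x : (N → O → ℝ) → Set (N → O) → (N → O))
    (p : (N → O → ℝ) → Set (N → O) → N → ℝ) : Prop :=
  ∀ (jx : Type) [Fintype jx] [Nonempty jx] (D : DynInstance N O S jx),
    DynValid Ω ι D → ∀ L : List (jx × ℝ) → jx → ℝ, IsLearningAlg L →
      dynWelfare x p ι D L ≥ β * dynOptWelfare ι D - dynRegret x p ι D L

end InvestmentFramework

section StaticToDynamic

variable {N O S ix : Type} [Fintype S] [DecidableEq N]

/-- Equalizing the utilities of two investments through their costs makes both of them best
responses, so a static approximation guarantee bounds the welfare of either investment by the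
optimal welfare of the other, corrected by the difference in utilities. -/
lemma ApproxStaticInv.welAt_add_utilAt_sub_le [Fintype N] {β : ℝ} {Ω : Set ((N → O → ℝ) × Set (N → O))}
    {ι : N} {x : (N → O → ℝ) → Set (N → O) → (N → O)}
    {p : (N → O → ℝ) → Set (N → O) → N → ℝ} (hβ : 0 ≤ β)
    (hstatic : ApproxStaticInv (S := S) β Ω ι x p) {w : StaticInstance N O S ix}
    (hw : StaticValid Ω ι w) (i j : ix) (s : S) :
    β * welOptAt ι w j s ≤
      welAt x ι w i s + (utilAt x p ι w j s - utilAt x p ι w i s) := by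
  classical
  let w' : StaticInstance N O S Bool :=
    ⟨Pi.single s 1, fun b => bif b then
      ((w.inv i).1, (w.inv i).2 + (utilAt x p ι w i s - utilAt x p ι w j s)) else w.inv j,
      w.vother, w.feas⟩
  have hsum (f : S → ℝ) : ∑ s', w'.g s' * f s' = f s := by
    simp [w', Pi.single_apply]
  have hvalid : StaticValid Ω ι w' := by
    refine ⟨fun s' => ?_, by simp [w'], ?_⟩
    · by_cases h : s' = s <;> simp [w', h]
    · rintro (_ | _) s'
      exacts [hw.2.2 j s', hw.2.2 i s']
  have hu : ∀ b, expUtil x p ι w' b = utilAt x p ι w j s := by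
    rintro (_ | _) <;> rw [expUtil, hsum]
    · rfl
    · simp only [utilAt, profOf, w', cond_true]
      ring
  have hopt : expWelOpt ι w' false = welOptAt ι w j s := by
    rw [expWelOpt, hsum]
    rfl
  have hwel : expWel x ι w' true =
      welAt x ι w i s + (utilAt x p ι w j s - utilAt x p ι w i s) := by
    rw [expWel, hsum]
    simp only [welAt, profOf, w', cond_true]
    ring
  have hmain := hstatic Bool w' hvalid true fun b => by rw [hu, hu]
  rw [← hopt, ← hwel]
  exact (mul_le_mul_of_nonneg_left
    (Finset.le_sup' (fun b => expWelOpt ι w' b) (Finset.mem_univ false)) hβ).trans hmain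

variable [Fintype ix] (x : (N → O → ℝ) → Set (N → O) → (N → O))
  (p : (N → O → ℝ) → Set (N → O) → N → ℝ) (ι : N) (D : DynInstance N O S ix)
  (L : List (ix × ℝ) → ix → ℝ)

lemma trajExp_add (ts : List (Fin D.T)) (h : List (ix × ℝ)) (F G : List (ix × S) → ℝ) :
    trajExp x p ι D L ts h (fun tr => F tr + G tr) =
      trajExp x p ι D L ts h F + trajExp x p ι D L ts h G := by
  induction ts generalizing h F G with
  | nil => rfl
  | cons t ts ih => simp only [trajExp, ih, mul_add, Finset.sum_add_distrib]

variable {L} in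
/-- A lower bound on a trajectory functional that is additive over the rounds and depends only on
the states passes to its expectation. -/
lemma add_sum_le_trajExp (hg : ∀ t s, 0 ≤ D.g t s) (hg1 : ∀ t, ∑ s, D.g t s = 1)
    (hL : IsLearningAlg L) (f : Fin D.T → S → ℝ) (ts : List (Fin D.T)) (h : List (ix × ℝ))
    (F : List (ix × S) → ℝ) (C : ℝ)
    (hF : ∀ tr, C + (List.zipWith (fun t (q : ix × S) => f t q.2) ts tr).sum ≤ F tr) :
    C + (ts.map fun t => ∑ s, D.g t s * f t s).sum ≤ trajExp x p ι D L ts h F := by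
  induction ts generalizing h F C with
  | nil => simpa [trajExp] using hF []
  | cons t ts ih =>
    set R := (ts.map fun t => ∑ s, D.g t s * f t s).sum with hR
    have hstate : ∑ s, D.g t s * (C + f t s + R) = C + ∑ s, D.g t s * f t s + R := by
      simp only [mul_add, Finset.sum_add_distrib, ← Finset.sum_mul, hg1, one_mul]
    calc C + ((t :: ts).map fun t => ∑ s, D.g t s * f t s).sum
        = ∑ i, ∑ s, L h i * D.g t s * (C + f t s + R) := by
          simp only [mul_assoc, ← Finset.mul_sum, hstate, ← Finset.sum_mul, (hL h).2, one_mul,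
            List.map_cons, List.sum_cons, ← hR]
          ring
      _ ≤ trajExp x p ι D L (t :: ts) h F := by
          refine Finset.sum_le_sum fun i _ => Finset.sum_le_sum fun s _ =>
            mul_le_mul_of_nonneg_left (ih _ _ _ fun tr => ?_)
              (mul_nonneg ((hL h).1 i) (hg t s))
          simpa [add_assoc] using hF ((i, s) :: tr)

end StaticToDynamic

/-- If `β ∈ [0,1]`, `Ω` is an allocation problem with product value
structure, `(x,p)` is a truthful mechanism for `Ω`, and `x` is a β-approximation for
static investment, then `x` is a β-approximation for dynamic investment:
for every dynamic investment instance and every online learning algorithm,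
`W̃_x(ω̃^T,ℒ) ≥ β·W̃*(ω̃^T) − Reg(ω̃^T,ℒ)`. -/
theorem static_approx_implies_dynamic_approx
    {N O S : Type} [Fintype N] [Fintype O] [Fintype S]
    [Nonempty N] [Nonempty O] [Nonempty S] [DecidableEq N]
    (β : ℝ) (hβ0 : 0 ≤ β) (hβ1 : β ≤ 1)
    (Ω : Set ((N → O → ℝ) × Set (N → O))) (V : N → O → Set ℝ)
    (x : (N → O → ℝ) → Set (N → O) → (N → O))
    (p : (N → O → ℝ) → Set (N → O) → N → ℝ) (ι : N)
    (hΩ : IsAllocProblem Ω) (hprod : ProductStructure Ω V)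
    (halg : IsAllocAlg Ω x) (htruth : Truthful Ω V x p)
    (hstatic : ApproxStaticInv (S := S) β Ω ι x p) :
    ApproxDynInv (S := S) β Ω ι x p := by
  intro jx _ _ D hD L hL
  obtain ⟨j, -, hj⟩ := Finset.exists_mem_eq_sup' Finset.univ_nonempty
    fun j : jx => ∑ t, expWelOpt ι (D.round t) j
  have hround (ts : List (Fin D.T)) (tr : List (jx × S)) :
      (List.zipWith (fun t (q : jx × S) => β * welOptAt ι (D.round t) j q.2) ts tr).sum ≤
        (List.zipWith (fun t (q : jx × S) => welAt x ι (D.round t) q.1 q.2) ts tr).sum +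
        ((List.zipWith (fun t (q : jx × S) => utilAt x p ι (D.round t) j q.2) ts tr).sum -
          (List.zipWith (fun t (q : jx × S) => utilAt x p ι (D.round t) q.1 q.2) ts tr).sum) := by
    induction ts generalizing tr with
    | nil => simp
    | cons t ts ih =>
      cases tr with
      | nil => simp
      | cons q tr =>
        have hq := hstatic.welAt_add_utilAt_sub_le hβ0 (hD t) q.1 j q.2
        simp only [List.zipWith_cons_cons, List.sum_cons]
        linarith [ih tr]
  have hmain : 0 + ((List.finRange D.T).map fun t =>
      ∑ s, D.g t s * (β * welOptAt ι (D.round t) j s)).sum ≤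
        dynWelfare x p ι D L + dynRegret x p ι D L := by
    rw [dynWelfare, dynRegret, ← trajExp_add]
    refine add_sum_le_trajExp x p ι D (fun t => (hD t).1) (fun t => (hD t).2.1) hL _ _ _ _ _
      fun tr => ?_
    rw [zero_add]
    refine (hround _ tr).trans (add_le_add_right (sub_le_sub_right ?_ _) _)
    exact Finset.le_sup' (fun i : jx => (List.zipWith
      (fun t (q : jx × S) => utilAt x p ι (D.round t) i q.2) (List.finRange D.T) tr).sum)
      (Finset.mem_univ j)
  have hopt : β * dynOptWelfare ι D = ((List.finRange D.T).map fun t =>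
      ∑ s, D.g t s * (β * welOptAt ι (D.round t) j s)).sum := by
    rw [dynOptWelfare, hj, Finset.mul_sum, ← List.ofFn_eq_map, List.sum_ofFn]
    refine Finset.sum_congr rfl fun t _ => ?_
    rw [expWelOpt, Finset.mul_sum]
    exact Finset.sum_congr rfl fun s _ => mul_left_comm _ _ _
  linarith
end

section
/- Let β ∈ [0,1], let Ω be an allocation problem with product value structure, and let (x,p) be a truthful mechanism for Ω such that x is a β-approximation for dynamic investment. Then x is a (β/|I|)-approximation for strongly dynamic investment on instances with nonnegative per-round optimal welfares: for every dynamic investment instance ω̃^T such that W̄*(ω̄^(t),ν_ι,c) ≥ 0 for all rounds t ∈ [T] and all investments (ν_ι,c) ∈ I, and for every online learning algorithm ℒ, W̃_x(ω̃^T,ℒ) ≥ (β/|I|)·W̃*_dyn(ω̃^T) − Reg(ω̃^T,ℒ). -/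
open Finset

/-- When every per-round optimal welfare is nonnegative, the time-varying benchmark is at most
`|I|` times the best fixed investment in hindsight. -/
theorem strongDynOptWelfare_le_card_mul_dynOptWelfare
    {N O S jx : Type} [Fintype N] [Fintype S] [DecidableEq N] [Fintype jx] [Nonempty jx]
    (ι : N) (D : DynInstance N O S jx)
    (hnn : ∀ (t : Fin D.T) (i : jx), 0 ≤ expWelOpt ι (D.round t) i) :
    strongDynOptWelfare ι D ≤ (Fintype.card jx : ℝ) * dynOptWelfare ι D := by
  calc strongDynOptWelfare ι D
      ≤ ∑ t, ∑ i, expWelOpt ι (D.round t) i :=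
        Finset.sum_le_sum fun t _ => Finset.sup'_le _ _ fun i hi =>
          Finset.single_le_sum (f := fun j => expWelOpt ι (D.round t) j)
            (fun j _ => hnn t j) hi
    _ = ∑ i, ∑ t, expWelOpt ι (D.round t) i := Finset.sum_comm
    _ ≤ ∑ _i : jx, dynOptWelfare ι D :=
        Finset.sum_le_sum fun i hi =>
          Finset.le_sup' (fun j : jx => ∑ t, expWelOpt ι (D.round t) j) hi
    _ = (Fintype.card jx : ℝ) * dynOptWelfare ι D := by simp

/-- If `β ∈ [0,1]`, `Ω` is an allocation problem with product value
structure, `(x,p)` is a truthful mechanism for `Ω`, and `x` is a β-approximation for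
dynamic investment, then `x` is a `β/|I|`-approximation for strongly dynamic
investment on instances whose per-round optimal welfares are nonnegative:
`W̃_x(ω̃^T,ℒ) ≥ (β/|I|)·W̃*_dyn(ω̃^T) − Reg(ω̃^T,ℒ)`. -/
theorem dynamic_approx_implies_strongly_dynamic_approx
    {N O S : Type} [Fintype N] [Fintype O] [Fintype S]
    [Nonempty N] [Nonempty O] [Nonempty S] [DecidableEq N]
    (β : ℝ) (hβ0 : 0 ≤ β) (hβ1 : β ≤ 1)
    (Ω : Set ((N → O → ℝ) × Set (N → O))) (V : N → O → Set ℝ)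
    (x : (N → O → ℝ) → Set (N → O) → (N → O))
    (p : (N → O → ℝ) → Set (N → O) → N → ℝ) (ι : N)
    (hΩ : IsAllocProblem Ω) (hprod : ProductStructure Ω V)
    (halg : IsAllocAlg Ω x) (htruth : Truthful Ω V x p)
    (hdyn : ApproxDynInv (S := S) β Ω ι x p) :
    ∀ (jx : Type) [Fintype jx] [Nonempty jx] (D : DynInstance N O S jx),
      DynValid Ω ι D →
      (∀ (t : Fin D.T) (i : jx), 0 ≤ expWelOpt ι (D.round t) i) →
      ∀ L : List (jx × ℝ) → jx → ℝ, IsLearningAlg L →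
        dynWelfare x p ι D L ≥
          (β / (Fintype.card jx : ℝ)) * strongDynOptWelfare ι D -
            dynRegret x p ι D L := by
  intro jx _ _ D hD hnn L hL
  have hcard : (0 : ℝ) < Fintype.card jx := by exact_mod_cast Fintype.card_pos
  have hbench : β / (Fintype.card jx : ℝ) * strongDynOptWelfare ι D ≤ β * dynOptWelfare ι D :=
    calc β / (Fintype.card jx : ℝ) * strongDynOptWelfare ι D
        ≤ β / (Fintype.card jx : ℝ) * ((Fintype.card jx : ℝ) * dynOptWelfare ι D) :=
          mul_le_mul_of_nonneg_left
            (strongDynOptWelfare_le_card_mul_dynOptWelfare ι D hnn) (by positivity)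
      _ = β * dynOptWelfare ι D := by field_simp
  have happrox := hdyn jx D hD L hL
  linarith
end

section
/- Consider the single-investor allocation problem: N = {ι}, O = {0,1}, every subset of outcomes assignments is feasible (the investor can always be allocated), the state set is S = {s_i : i ∈ I₀} for a finite nonempty index set I₀, the investment set is I = {(1_{s_i}, 0) : i ∈ I₀} where 1_{s_i}(s) = 1 if s = s_i and 0 otherwise, the allocation algorithm x is the optimal one (it always allocates outcome 1 to the investor, so W_x = W*), and the payment is identically 0. For a sequence j = (j_1,…,j_T) ∈ I₀^T, let ω̃_j^T be the dynamic investment instance in which g^(t) is the point mass at s_{j_t}. Then: (i) W̃*_dyn(ω̃_j^T) = T for every j; and (ii) for every online learning algorithm ℒ, the average over uniformly random j ∈ I₀^T of W̃_x(ω̃_j^T, ℒ) equals T/|I₀|. Consequently, for every online learning algorithm ℒ there exists j ∈ I₀^T with W̃_x(ω̃_j^T, ℒ) ≤ (1/|I₀|)·W̃*_dyn(ω̃_j^T). -/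
open Finset

section SingleInvestor

variable (I₀ : Type) [DecidableEq I₀]

/-- The optimal allocation algorithm in the single-investor problem with outcomes
`{0,1} = Bool` and all allocations feasible: it always allocates (outcome `true`)
to the investor, hence `W_x = W*`. -/
def optAllocAlg : (Unit → Bool → ℝ) → Set (Unit → Bool) → (Unit → Bool) :=
  fun _ _ _ => true

/-- The all-zero payment rule. -/
def zeroPay : (Unit → Bool → ℝ) → Set (Unit → Bool) → Unit → ℝ :=
  fun _ _ _ => 0

/-- The dynamic investment instance `ω̃_j^T` of the single-investor problem:
states `S = I₀`, investments `I = {(1_{s_i}, 0) : i ∈ I₀}` (value `1` for being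
allocated at state `s_i`, zero elsewhere, zero cost), every allocation feasible,
and the round-`t` state distribution being the point mass at `s_{j_t}`. -/
def pointInst (T : ℕ) (j : Fin T → I₀) : DynInstance Unit Bool I₀ I₀ where
  T := T
  inv := fun i => (fun s o => if s = i ∧ o = true then 1 else 0, 0)
  g := fun t s => if s = j t then 1 else 0
  vother := fun _ _ _ _ => 0
  feas := fun _ _ => Set.univ

end SingleInvestor

section SingleInvestor

variable {I₀ : Type} [DecidableEq I₀]

theorem utilAt_pointInst {T : ℕ} (j : Fin T → I₀) (t : Fin T) (i s : I₀) :
    utilAt optAllocAlg zeroPay () ((pointInst I₀ T j).round t) i s = if s = i then 1 else 0 := by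
  simp [utilAt, optAllocAlg, zeroPay, pointInst, DynInstance.round]

theorem welAt_pointInst {T : ℕ} (j : Fin T → I₀) (t : Fin T) (i s : I₀) :
    welAt optAllocAlg () ((pointInst I₀ T j).round t) i s = if s = i then 1 else 0 := by
  simp [welAt, WelfareOf, allocWelfare, profOf, optAllocAlg, pointInst, DynInstance.round]

theorem welOptAt_pointInst {T : ℕ} (j : Fin T → I₀) (t : Fin T) (i s : I₀) :
    welOptAt () ((pointInst I₀ T j).round t) i s = if s = i then 1 else 0 := by
  have h : IsGreatest ((fun a : Unit → Bool =>
      allocWelfare (profOf () ((pointInst I₀ T j).round t) i s) a) '' Set.univ)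
      (if s = i then 1 else 0) := by
    constructor
    · exact ⟨fun _ => true, trivial, by
        simp [allocWelfare, profOf, pointInst, DynInstance.round]⟩
    · rintro _ ⟨a, -, rfl⟩
      by_cases hs : s = i <;> cases ha : a () <;>
        simp [allocWelfare, profOf, pointInst, DynInstance.round, hs, ha]
  have h' := h.csSup_eq
  simpa [welOptAt, Wstar, pointInst, DynInstance.round] using h'

variable [Fintype I₀]

theorem expWelOpt_pointInst {T : ℕ} (j : Fin T → I₀) (t : Fin T) (i : I₀) :
    expWelOpt () ((pointInst I₀ T j).round t) i = if j t = i then 1 else 0 := by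
  simp only [expWelOpt, welOptAt_pointInst]
  simp [pointInst, DynInstance.round, eq_comm]

theorem strongDynOptWelfare_pointInst [Nonempty I₀] {T : ℕ} (j : Fin T → I₀) :
    strongDynOptWelfare () (pointInst I₀ T j) = (T : ℝ) := by
  have h (t : Fin T) : (univ.sup' univ_nonempty fun i : I₀ =>
      expWelOpt () ((pointInst I₀ T j).round t) i) = 1 := by
    simp only [expWelOpt_pointInst]
    apply le_antisymm
    · exact sup'_le _ _ fun i _ => by split_ifs <;> norm_num
    · exact le_sup'_of_le _ (mem_univ (j t)) (by simp)
  calc strongDynOptWelfare () (pointInst I₀ T j) = ∑ _t : Fin T, (1 : ℝ) :=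
        sum_congr rfl fun t _ => h t
    _ = T := by simp

/-- The expected number of correct guesses made by the learning algorithm `L`, started with
history `h`, against a fixed sequence of states. -/
noncomputable def expCorrect (L : List (I₀ × ℝ) → I₀ → ℝ) : List I₀ → List (I₀ × ℝ) → ℝ
  | [], _ => 0
  | s :: ss, h => ∑ i, L h i *
      ((if s = i then 1 else 0) + expCorrect L ss (h ++ [(i, if s = i then 1 else 0)]))

theorem trajExp_eq_expCorrect {L : List (I₀ × ℝ) → I₀ → ℝ} (hL : IsLearningAlg L)
    (D : DynInstance Unit Bool I₀ I₀) (j : Fin D.T → I₀)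
    (hg : ∀ t s, D.g t s = if s = j t then 1 else 0)
    (hu : ∀ t i s, utilAt optAllocAlg zeroPay () (D.round t) i s = if s = i then 1 else 0)
    (hw : ∀ t i s, welAt optAllocAlg () (D.round t) i s = if s = i then 1 else 0)
    (ts : List (Fin D.T)) (h : List (I₀ × ℝ)) (c : ℝ) :
    trajExp optAllocAlg zeroPay () D L ts h
      (fun tr => c + (List.zipWith (fun t (q : I₀ × I₀) =>
        welAt optAllocAlg () (D.round t) q.1 q.2) ts tr).sum) =
      c + expCorrect L (ts.map j) h := by
  induction ts generalizing h c with
  | nil => simp [trajExp, expCorrect]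
  | cons t ts ih =>
    simp only [trajExp, List.zipWith_cons_cons, List.sum_cons, ← add_assoc, ih, hg, hu]
    simp only [hw, mul_ite, mul_one, mul_zero, ite_mul, zero_mul, sum_ite_eq', mem_univ, if_true,
      List.map_cons, expCorrect]
    have hc : c = ∑ i, L h i * c := by rw [← sum_mul, (hL h).2, one_mul]
    conv_rhs => rw [hc, ← sum_add_distrib]
    exact sum_congr rfl fun i _ => by ring

theorem dynWelfare_pointInst {L : List (I₀ × ℝ) → I₀ → ℝ} (hL : IsLearningAlg L) {T : ℕ}
    (j : Fin T → I₀) :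
    dynWelfare optAllocAlg zeroPay () (pointInst I₀ T j) L = expCorrect L (List.ofFn j) [] := by
  have h := trajExp_eq_expCorrect hL (pointInst I₀ T j) j (fun _ _ => rfl)
    (utilAt_pointInst j) (welAt_pointInst j) (List.finRange T) [] 0
  simp only [zero_add] at h
  rw [List.ofFn_eq_map]
  exact h

theorem card_mul_sum_expCorrect {L : List (I₀ × ℝ) → I₀ → ℝ} (hL : IsLearningAlg L) (T : ℕ)
    (h : List (I₀ × ℝ)) :
    (Fintype.card I₀ : ℝ) * ∑ j : Fin T → I₀, expCorrect L (List.ofFn j) h =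
      T * (Fintype.card I₀ : ℝ) ^ T := by
  induction T generalizing h with
  | zero => simp [expCorrect]
  | succ T ih =>
    have hi (i : I₀) : (Fintype.card I₀ : ℝ) * ∑ s : I₀, ∑ j : Fin T → I₀,
        ((if s = i then 1 else 0) +
          expCorrect L (List.ofFn j) (h ++ [(i, if s = i then 1 else 0)])) =
        (T + 1 : ℝ) * (Fintype.card I₀ : ℝ) ^ (T + 1) := by
      simp only [sum_add_distrib, mul_add, mul_sum (s := univ (α := I₀)), ih]
      simp
      ring
    have hcons (F : (Fin (T + 1) → I₀) → ℝ) :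
        ∑ j, F j = ∑ s, ∑ j : Fin T → I₀, F (Fin.cons s j) :=
      ((Fin.consEquiv fun _ => I₀).sum_comp F).symm.trans (Fintype.sum_prod_type _)
    simp only [hcons, List.ofFn_cons, expCorrect]
    calc _ = ∑ i, L h i * ((Fintype.card I₀ : ℝ) * ∑ s : I₀, ∑ j : Fin T → I₀,
        ((if s = i then 1 else 0) +
          expCorrect L (List.ofFn j) (h ++ [(i, if s = i then 1 else 0)]))) := by
          simp_rw [sum_comm (s := univ (α := Fin T → I₀)) (t := univ (α := I₀))]
          rw [sum_comm, mul_sum]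
          refine sum_congr rfl fun i _ => ?_
          simp_rw [← mul_sum]
          ring
      _ = _ := by
          simp_rw [hi]
          rw [← sum_mul, (hL h).2]
          push_cast
          ring

theorem average_dynWelfare_pointInst [Nonempty I₀] {L : List (I₀ × ℝ) → I₀ → ℝ}
    (hL : IsLearningAlg L) (T : ℕ) :
    (∑ j : Fin T → I₀, dynWelfare optAllocAlg zeroPay () (pointInst I₀ T j) L) /
      ((Fintype.card I₀ : ℝ) ^ T) = (T : ℝ) / (Fintype.card I₀ : ℝ) := by
  have hcard : (Fintype.card I₀ : ℝ) ≠ 0 := Nat.cast_ne_zero.2 Fintype.card_ne_zero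
  simp only [dynWelfare_pointInst hL]
  rw [div_eq_div_iff (pow_ne_zero _ hcard) hcard, mul_comm, card_mul_sum_expCorrect hL]

end SingleInvestor

/-- In the single-investor problem: (i) the strongly dynamic welfare
of `ω̃_j^T` is `T` for every `j`; (ii) for every online learning algorithm `ℒ`, the
average over uniformly random `j ∈ I₀^T` of `W̃_x(ω̃_j^T, ℒ)` equals `T/|I₀|`;
consequently, for every `ℒ` there exists `j` with
`W̃_x(ω̃_j^T, ℒ) ≤ (1/|I₀|)·W̃*_dyn(ω̃_j^T)`. -/
theorem single_investor_lower_bound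
    {I₀ : Type} [Fintype I₀] [Nonempty I₀] [DecidableEq I₀] (T : ℕ) :
    (∀ j : Fin T → I₀, strongDynOptWelfare () (pointInst I₀ T j) = (T : ℝ)) ∧
    (∀ L : List (I₀ × ℝ) → I₀ → ℝ, IsLearningAlg L →
      (∑ j : Fin T → I₀, dynWelfare optAllocAlg zeroPay () (pointInst I₀ T j) L) /
          ((Fintype.card I₀ : ℝ) ^ T) =
        (T : ℝ) / (Fintype.card I₀ : ℝ)) ∧
    (∀ L : List (I₀ × ℝ) → I₀ → ℝ, IsLearningAlg L →
      ∃ j : Fin T → I₀,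
        dynWelfare optAllocAlg zeroPay () (pointInst I₀ T j) L ≤
          (1 / (Fintype.card I₀ : ℝ)) * strongDynOptWelfare () (pointInst I₀ T j)) := by
  refine ⟨strongDynOptWelfare_pointInst, fun L hL => average_dynWelfare_pointInst hL T,
    fun L hL => ?_⟩
  by_contra! hlt
  have hcard : (0 : ℝ) < (Fintype.card I₀ : ℝ) ^ T :=
    pow_pos (Nat.cast_pos.2 Fintype.card_pos) T
  have hsum := sum_lt_sum_of_nonempty (univ_nonempty (α := Fin T → I₀)) fun j _ => hlt j
  simp only [strongDynOptWelfare_pointInst, sum_const, card_univ, Fintype.card_fun,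
    Fintype.card_fin, nsmul_eq_mul, Nat.cast_pow] at hsum
  have havg := average_dynWelfare_pointInst hL T
  rw [div_eq_iff hcard.ne'] at havg
  rw [havg] at hsum
  exact hsum.ne (by ring)
end

section
/- Let β ∈ [0,1], let Ω be an allocation problem with product value structure, and let (x,p) be a truthful mechanism for Ω such that x is a β-approximation for static investment. Let ω̄ = (g, I, ν_{−ι}, 𝒜) be a static investment instance, let s ∈ S be any state, and let (ν*_ι,c*), (ν_ι,c) ∈ I be any two investments. Set δ = u(ω̄,s,ν*_ι,c*) − u(ω̄,s,ν_ι,c). Then the realized welfare satisfies W̄_x(ω̄,s,ν_ι,c) ≥ β·W̄*(ω̄,s,ν*_ι,c*) − δ. -/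
open Finset

/-- The instance concentrated on state `s` that offers two investments: `istar` with its original
cost (index `true`), and `i` with its cost lowered by `d` (index `false`). -/
noncomputable def subsidizedPair {N O S ix : Type} (w : StaticInstance N O S ix) (s : S)
    (istar i : ix) (d : ℝ) : StaticInstance N O S Bool where
  g := open Classical in Pi.single s 1
  inv b := if b then w.inv istar else ((w.inv i).1, (w.inv i).2 - d)
  vother := w.vother
  feas := w.feas

theorem sum_subsidizedPair_g_mul {N O S ix : Type} [Fintype S] (w : StaticInstance N O S ix)
    (s : S) (istar i : ix) (d : ℝ) (f : S → ℝ) :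
    ∑ t, (subsidizedPair w s istar i d).g t * f t = f s := by
  classical
  simp [subsidizedPair, Pi.single_apply]

theorem StaticValid.subsidizedPair {N O S ix : Type} [Fintype S] [DecidableEq N]
    {Ω : Set ((N → O → ℝ) × Set (N → O))} {ι : N} {w : StaticInstance N O S ix}
    (hw : StaticValid Ω ι w) (s : S) (istar i : ix) (d : ℝ) :
    StaticValid Ω ι (subsidizedPair w s istar i d) := by
  classical
  refine ⟨fun t => ?_, ?_, ?_⟩
  · simp only [_root_.subsidizedPair, Pi.single_apply]
    split_ifs <;> norm_num
  · simpa using sum_subsidizedPair_g_mul w s istar i d fun _ => 1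
  · rintro (_ | _) t
    · exact hw.2.2 i t
    · exact hw.2.2 istar t

/-- Let `β ∈ [0,1]`, `Ω` an allocation problem with product value
structure, `(x,p)` a truthful mechanism for `Ω` with `x` a β-approximation for
static investment. For any static investment instance `ω̄`, state `s`, and
investments `(ν*_ι,c*)`, `(ν_ι,c)`, setting
`δ = u(ω̄,s,ν*_ι,c*) − u(ω̄,s,ν_ι,c)`, the realized welfare satisfies
`W̄_x(ω̄,s,ν_ι,c) ≥ β·W̄*(ω̄,s,ν*_ι,c*) − δ`. -/
theorem suboptimal_investment_welfare_bound
    {N O S : Type} [Fintype N] [Fintype O] [Fintype S]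
    [Nonempty N] [Nonempty O] [Nonempty S] [DecidableEq N]
    (β : ℝ) (hβ0 : 0 ≤ β) (hβ1 : β ≤ 1)
    (Ω : Set ((N → O → ℝ) × Set (N → O))) (V : N → O → Set ℝ)
    (x : (N → O → ℝ) → Set (N → O) → (N → O))
    (p : (N → O → ℝ) → Set (N → O) → N → ℝ) (ι : N)
    (hΩ : IsAllocProblem Ω) (hprod : ProductStructure Ω V)
    (halg : IsAllocAlg Ω x) (htruth : Truthful Ω V x p)
    (hstatic : ApproxStaticInv (S := S) β Ω ι x p)
    {jx : Type} [Fintype jx] [Nonempty jx]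
    (w : StaticInstance N O S jx) (hw : StaticValid Ω ι w)
    (s : S) (istar i : jx) :
    welAt x ι w i s ≥
      β * welOptAt ι w istar s -
        (utilAt x p ι w istar s - utilAt x p ι w i s) := by
  set d := utilAt x p ι w istar s - utilAt x p ι w i s with hd
  have util_true : utilAt x p ι (subsidizedPair w s istar i d) true s
      = utilAt x p ι w istar s := rfl
  have util_false : utilAt x p ι (subsidizedPair w s istar i d) false s
      = utilAt x p ι w i s + d := by
    simp only [utilAt, profOf, subsidizedPair, Bool.false_eq_true, if_false]
    ring
  have wel_false : welAt x ι (subsidizedPair w s istar i d) false s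
      = welAt x ι w i s + d := by
    simp only [welAt, profOf, subsidizedPair, Bool.false_eq_true, if_false]
    ring
  have opt_true : welOptAt ι (subsidizedPair w s istar i d) true s
      = welOptAt ι w istar s := rfl
  have mem_BR : false ∈ BRset x p ι (subsidizedPair w s istar i d) := by
    rintro (_ | _)
    · exact le_rfl
    · rw [expUtil, expUtil, sum_subsidizedPair_g_mul, sum_subsidizedPair_g_mul,
        util_true, util_false]
      linarith
  have approx := hstatic Bool _ (hw.subsidizedPair s istar i d) false mem_BR
  have opt_le := mul_le_mul_of_nonneg_left (Finset.le_sup'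
    (fun j => expWelOpt ι (subsidizedPair w s istar i d) j) (Finset.mem_univ true)) hβ0
  rw [expWel, sum_subsidizedPair_g_mul, wel_false] at approx
  rw [expWelOpt, sum_subsidizedPair_g_mul, opt_true] at opt_le
  linarith
end

section
/- Consider the adversarial multi-armed bandit problem with K ≥ 2 arms and horizon T ≥ 1: rewards u_t(i) ∈ [0,1] are fixed in advance for each round t ∈ {1,…,T} and arm i ∈ {1,…,K}; at each round the learner selects an arm i_t at random based only on its internal randomness and the previously observed rewards u_1(i_1),…,u_{t−1}(i_{t−1}), and observes only u_t(i_t). The EXP3 algorithm with parameter γ = min{1, √(K ln K / ((e−1)T))} — which initializes weights q_1(i) = 1, at each round samples i_t from the distribution p_t(i) = (1−γ)·q_t(i)/Σ_{j} q_t(j) + γ/K, and updates q_{t+1}(i_t) = q_t(i_t)·exp(γ·u_t(i_t)/(K·p_t(i_t))) leaving all other weights unchanged — guarantees expected regret max_{i∈{1,…,K}} Σ_{t=1}^T u_t(i) − E[Σ_{t=1}^T u_t(i_t)] ≤ 2√(e−1)·√(T·K·ln K). -/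
open Finset

/-- The EXP3 sampling distribution with exploration parameter `γ`, given current
weights `q` over `K` arms: `p(i) = (1−γ)·q(i)/Σ_j q(j) + γ/K`. -/
noncomputable def exp3Prob (γ : ℝ) (K : ℕ) (q : Fin K → ℝ) (i : Fin K) : ℝ :=
  (1 - γ) * q i / (∑ j, q j) + γ / (K : ℝ)

/-- The EXP3 weight update after pulling arm `i` and observing reward `u`:
`q(i) ← q(i)·exp(γ·u/(K·p(i)))`, all other weights unchanged. -/
noncomputable def exp3Update (γ : ℝ) (K : ℕ) (q : Fin K → ℝ) (i : Fin K) (u : ℝ) :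
    Fin K → ℝ :=
  Function.update q i (q i * Real.exp (γ * u / ((K : ℝ) * exp3Prob γ K q i)))

/-- The expected total reward collected by EXP3 over the rounds
`t, t+1, …, t+fuel−1` starting from weights `q`, against the fixed reward table
`u` (the expectation is over the arms sampled by EXP3). -/
noncomputable def exp3ExpReward (γ : ℝ) {K : ℕ} (u : ℕ → Fin K → ℝ) :
    ℕ → ℕ → (Fin K → ℝ) → ℝ
  | 0, _, _ => 0
  | fuel + 1, t, q =>
      ∑ i, exp3Prob γ K q i *
        (u t i + exp3ExpReward γ u fuel (t + 1) (exp3Update γ K q i (u t i)))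

lemma Real.exp_le_one_add_add_mul_sq {y : ℝ} (h0 : 0 ≤ y) (h1 : y ≤ 1) :
    Real.exp y ≤ 1 + y + (Real.exp 1 - 2) * y ^ 2 := by
  have tail (x : ℝ) : HasSum (fun n : ℕ => x ^ (n + 2) / ((n + 2).factorial : ℝ))
      (Real.exp x - (1 + x)) := by
    have h := NormedSpace.expSeries_div_hasSum_exp (𝔸 := ℝ) x
    rw [← Real.exp_eq_exp_ℝ, ← hasSum_nat_add_iff' 2] at h
    simpa [Finset.sum_range_succ] using h
  have h := hasSum_le (fun n => ?_) (tail y) ((tail 1).mul_left (y ^ 2))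
  · linarith
  · rw [one_pow, mul_one_div]
    gcongr ?_ / _
    exact pow_le_pow_of_le_one h0 h1 (by omega)

section Exp3

variable {γ : ℝ} {K : ℕ} {q : Fin K → ℝ}

lemma sum_exp3Prob [NeZero K] (hq : ∀ i, 0 < q i) : ∑ i, exp3Prob γ K q i = 1 := by
  have hW : 0 < ∑ j, q j := Finset.sum_pos (fun i _ => hq i) Finset.univ_nonempty
  have hK : (K : ℝ) ≠ 0 := NeZero.ne _
  simp only [exp3Prob, Finset.sum_add_distrib, ← Finset.sum_div, ← Finset.mul_sum,
    Finset.sum_const, Finset.card_univ, Fintype.card_fin, nsmul_eq_mul]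
  field_simp
  ring

lemma div_le_exp3Prob (hγ1 : γ ≤ 1) (hq : ∀ i, 0 < q i) (i : Fin K) :
    γ / K ≤ exp3Prob γ K q i :=
  le_add_of_nonneg_left <| div_nonneg (mul_nonneg (by linarith) (hq i).le)
    (Finset.sum_nonneg fun j _ => (hq j).le)

lemma exp3Prob_pos [NeZero K] (hγ0 : 0 < γ) (hγ1 : γ ≤ 1) (hq : ∀ i, 0 < q i) (i : Fin K) :
    0 < exp3Prob γ K q i :=
  (div_pos hγ0 (Nat.cast_pos.2 (NeZero.pos K))).trans_le (div_le_exp3Prob hγ1 hq i)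

lemma exp3Update_pos (hq : ∀ i, 0 < q i) (i : Fin K) (x : ℝ) (j : Fin K) :
    0 < exp3Update γ K q i x j := by
  rcases eq_or_ne j i with rfl | h
  · simpa [exp3Update] using mul_pos (hq j) (Real.exp_pos _)
  · simpa [exp3Update, h] using hq j

/-- The scaled logarithmic share of arm `j` in the total weight. -/
noncomputable def exp3Potential (γ : ℝ) (K : ℕ) (j : Fin K) (q : Fin K → ℝ) : ℝ :=
  (1 - γ) * (K / γ) * (Real.log (q j) - Real.log (∑ i, q i))

lemma exp3Potential_exp3Update_ge [NeZero K] (hγ0 : 0 < γ) (hγ1 : γ ≤ 1) (hq : ∀ i, 0 < q i)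
    (i j : Fin K) {x : ℝ} (hx0 : 0 ≤ x) (hx1 : x ≤ 1) :
    exp3Potential γ K j q + (if i = j then (1 - γ) * (x / exp3Prob γ K q i) else 0) - x
        - (Real.exp 1 - 2) * (γ * x / (K * exp3Prob γ K q i)) ≤
      exp3Potential γ K j (exp3Update γ K q i x) := by
  have hK : (0 : ℝ) < K := Nat.cast_pos.2 (NeZero.pos K)
  have hp := exp3Prob_pos hγ0 hγ1 hq i
  have hW : 0 < ∑ j, q j := Finset.sum_pos (fun i _ => hq i) Finset.univ_nonempty
  have hW' : 0 < ∑ j, exp3Update γ K q i x j :=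
    Finset.sum_pos (fun j _ => exp3Update_pos hq i x j) Finset.univ_nonempty
  set y := γ * x / (K * exp3Prob γ K q i) with hy
  have hy0 : 0 ≤ y := by positivity
  have hy1 : y ≤ 1 := by
    have := div_le_exp3Prob hγ1 hq i
    rw [div_le_iff₀ hK] at this
    rw [hy, div_le_one (by positivity)]
    nlinarith
  have hsum : ∑ j, exp3Update γ K q i x j = ∑ j, q j + q i * (Real.exp y - 1) := by
    have h1 := Finset.sum_update_of_mem (Finset.mem_univ i) q (q i * Real.exp y)
    have h2 := Finset.sum_update_of_mem (Finset.mem_univ i) q (q i)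
    rw [Function.update_eq_self] at h2
    simp only [exp3Update, ← hy, h1]
    linarith
  have hlogj : Real.log (exp3Update γ K q i x j) = Real.log (q j) + if i = j then y else 0 := by
    rcases eq_or_ne i j with rfl | h
    · simp [exp3Update, ← hy, Real.log_mul (hq i).ne' (Real.exp_pos y).ne']
    · simp [exp3Update, h, h.symm]
  have hlogW : Real.log (∑ j, exp3Update γ K q i x j) - Real.log (∑ j, q j) ≤
      q i / (∑ j, q j) * (y + (Real.exp 1 - 2) * y ^ 2) := by
    rw [← Real.log_div hW'.ne' hW.ne']
    refine (Real.log_le_sub_one_of_pos (div_pos hW' hW)).trans ?_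
    have : (∑ j, exp3Update γ K q i x j) / (∑ j, q j) - 1 =
        q i / (∑ j, q j) * (Real.exp y - 1) := by
      rw [hsum]; field_simp; ring
    rw [this]
    refine mul_le_mul_of_nonneg_left ?_ (div_nonneg (hq i).le hW.le)
    linarith [Real.exp_le_one_add_add_mul_sq hy0 hy1]
  have he : 0 ≤ Real.exp 1 - 2 := by linarith [Real.add_one_le_exp (1 : ℝ)]
  have hpq : (1 - γ) * (q i / ∑ j, q j) ≤ exp3Prob γ K q i := by
    rw [exp3Prob, mul_div_assoc]
    exact le_add_of_nonneg_right (by positivity)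
  have hgrow : (1 - γ) * (K / γ) *
      (Real.log (∑ j, exp3Update γ K q i x j) - Real.log (∑ j, q j)) ≤
        x + (Real.exp 1 - 2) * y := by
    calc _ ≤ (1 - γ) * (K / γ) * (q i / (∑ j, q j) * (y + (Real.exp 1 - 2) * y ^ 2)) :=
          mul_le_mul_of_nonneg_left hlogW (mul_nonneg (by linarith) (by positivity))
      _ = (1 - γ) * (q i / ∑ j, q j) * (K / γ * (y + (Real.exp 1 - 2) * y ^ 2)) := by ring
      _ ≤ exp3Prob γ K q i * (K / γ * (y + (Real.exp 1 - 2) * y ^ 2)) :=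
          mul_le_mul_of_nonneg_right hpq (by positivity)
      _ = (exp3Prob γ K q i * (K / γ) * y) * (1 + (Real.exp 1 - 2) * y) := by ring
      _ = x * (1 + (Real.exp 1 - 2) * y) := by
          congr 1
          rw [hy]; field_simp
      _ ≤ x + (Real.exp 1 - 2) * y := by
          nlinarith [mul_nonneg he hy0]
  have hgain : (1 - γ) * (K / γ) * (if i = j then y else 0) =
      if i = j then (1 - γ) * (x / exp3Prob γ K q i) else 0 := by
    split_ifs
    · rw [hy]; field_simp
    · simp
  rw [exp3Potential, exp3Potential, hlogj, ← hgain]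
  linarith

lemma exp3ExpReward_ge [NeZero K] (hγ0 : 0 < γ) (hγ1 : γ ≤ 1) {u : ℕ → Fin K → ℝ} (j : Fin K)
    (n t : ℕ) (hu : ∀ s, s < n → ∀ i, 0 ≤ u (t + s) i ∧ u (t + s) i ≤ 1) (hq : ∀ i, 0 < q i) :
    exp3Potential γ K j q + (1 - γ) * ∑ s ∈ Finset.range n, u (t + s) j
        - (Real.exp 1 - 2) * γ * n ≤ exp3ExpReward γ u n t q := by
  induction n generalizing t q with
  | zero =>
    have hle : q j ≤ ∑ i, q i :=
      Finset.single_le_sum (fun i _ => (hq i).le) (Finset.mem_univ j)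
    have : exp3Potential γ K j q ≤ 0 :=
      mul_nonpos_of_nonneg_of_nonpos (mul_nonneg (by linarith) (by positivity))
        (sub_nonpos.2 (Real.log_le_log (hq j) hle))
    simpa [exp3ExpReward] using this
  | succ n ih =>
    have hK : (0 : ℝ) < K := Nat.cast_pos.2 (NeZero.pos K)
    have he : 0 ≤ Real.exp 1 - 2 := by linarith [Real.add_one_le_exp (1 : ℝ)]
    have hut (i : Fin K) : 0 ≤ u t i ∧ u t i ≤ 1 := hu 0 (by omega) i
    set C := (1 - γ) * ∑ s ∈ Finset.range n, u (t + 1 + s) j - (Real.exp 1 - 2) * γ * n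
    have hterm (i : Fin K) :
        exp3Prob γ K q i * (exp3Potential γ K j q + C) +
          (if i = j then (1 - γ) * u t i else 0) - (Real.exp 1 - 2) * γ / K * u t i ≤
        exp3Prob γ K q i *
          (u t i + exp3ExpReward γ u n (t + 1) (exp3Update γ K q i (u t i))) := by
      have hp := exp3Prob_pos hγ0 hγ1 hq i
      have hrec := ih (t + 1)
        (fun s hs k => by simpa [add_assoc, add_comm 1 s] using hu (s + 1) (by omega) k)
        (exp3Update_pos (γ := γ) hq i (u t i))
      have hstep := exp3Potential_exp3Update_ge hγ0 hγ1 hq i j (hut i).1 (hut i).2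
      refine le_trans (le_of_eq ?_) (mul_le_mul_of_nonneg_left (a := exp3Prob γ K q i)
        (b := exp3Potential γ K j q + C +
          (if i = j then (1 - γ) * (u t i / exp3Prob γ K q i) else 0)
          - (Real.exp 1 - 2) * (γ * u t i / (K * exp3Prob γ K q i))) ?_ hp.le)
      · split_ifs <;> (field_simp; try ring)
      · linarith
    have hsum := Finset.sum_le_sum fun i (_ : i ∈ Finset.univ) => hterm i
    simp only [Finset.sum_sub_distrib, Finset.sum_add_distrib, ← Finset.sum_mul,
      ← Finset.mul_sum, sum_exp3Prob hq, one_mul, Finset.sum_ite_eq', Finset.mem_univ,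
      if_true] at hsum
    have hbound : (Real.exp 1 - 2) * γ / K * ∑ i, u t i ≤ (Real.exp 1 - 2) * γ := by
      have : ∑ i, u t i ≤ K := by
        simpa using Finset.sum_le_sum fun i (_ : i ∈ Finset.univ) => (hut i).2
      calc _ ≤ (Real.exp 1 - 2) * γ / K * K := by gcongr
        _ = _ := by field_simp
    have hsplit : ∑ s ∈ Finset.range (n + 1), u (t + s) j =
        ∑ s ∈ Finset.range n, u (t + 1 + s) j + u t j := by
      rw [Finset.sum_range_succ']
      simp [add_assoc, add_comm 1]
    rw [exp3ExpReward, hsplit]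
    push_cast
    linarith

end Exp3

lemma min_one_sqrt_tradeoff {a b : ℝ} (ha : 0 < a) (hb : 0 < b) :
    a * min 1 √(b / a) + (1 - min 1 √(b / a)) * (b / min 1 √(b / a)) ≤ 2 * (√a * √b) := by
  have hsa := Real.sqrt_pos.2 ha
  have hsb := Real.sqrt_pos.2 hb
  have ha2 := Real.sq_sqrt ha.le
  have hb2 := Real.sq_sqrt hb.le
  rw [Real.sqrt_div hb.le]
  rcases le_total 1 (√b / √a) with h | h
  · rw [min_eq_left h]
    rw [one_le_div hsa] at h
    nlinarith
  · rw [min_eq_right h]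
    have h1 : a * (√b / √a) = √a * √b := by
      rw [mul_div_assoc', div_eq_iff hsa.ne']; nlinarith
    have h2 : b / (√b / √a) = √a * √b := by
      rw [div_div_eq_mul_div, div_eq_iff hsb.ne']; nlinarith
    rw [h1, h2]
    have : 0 ≤ √b / √a * (√a * √b) := by positivity
    linarith

/-- In the adversarial multi-armed bandit problem with `K ≥ 2` arms,
horizon `T ≥ 1`, and rewards `u t i ∈ [0,1]` fixed in advance, the EXP3 algorithm
with parameter `γ = min{1, √(K ln K / ((e−1)T))}` (weights initialized at `1`)
has expected regret at most `2√(e−1)·√(T·K·ln K)`. -/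
theorem exp3_regret_bound (K T : ℕ) (hK : 2 ≤ K) (hT : 1 ≤ T)
    (u : ℕ → Fin K → ℝ) (hu : ∀ t, t < T → ∀ i, 0 ≤ u t i ∧ u t i ≤ 1) :
    (Finset.univ.sup' (⟨⟨0, by omega⟩, Finset.mem_univ _⟩ :
        (Finset.univ : Finset (Fin K)).Nonempty)
      fun i => ∑ t ∈ Finset.range T, u t i) -
      exp3ExpReward
        (min 1 (Real.sqrt (((K : ℝ) * Real.log K) / ((Real.exp 1 - 1) * (T : ℝ)))))
        u T 0 (fun _ => 1) ≤
    2 * Real.sqrt (Real.exp 1 - 1) * Real.sqrt ((T : ℝ) * (K : ℝ) * Real.log K) := by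
  have : NeZero K := ⟨by omega⟩
  have hT0 : (0 : ℝ) < T := Nat.cast_pos.2 (by omega)
  have hK1 : (1 : ℝ) < K := Nat.one_lt_cast.2 (by omega)
  have he : 0 < Real.exp 1 - 1 := by linarith [Real.add_one_le_exp (1 : ℝ)]
  have hb : 0 < (K : ℝ) * Real.log K := mul_pos (by linarith) (Real.log_pos hK1)
  have ha : 0 < (Real.exp 1 - 1) * (T : ℝ) := mul_pos he hT0
  have htrade := min_one_sqrt_tradeoff ha hb
  have hγ0 : 0 < min 1 √((K : ℝ) * Real.log K / ((Real.exp 1 - 1) * (T : ℝ))) :=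
    lt_min one_pos (Real.sqrt_pos.2 (div_pos hb ha))
  have hγ1 := min_le_left 1 √((K : ℝ) * Real.log K / ((Real.exp 1 - 1) * (T : ℝ)))
  set γ := min 1 √((K : ℝ) * Real.log K / ((Real.exp 1 - 1) * (T : ℝ)))
  rw [Real.sqrt_mul he.le, mul_assoc √_, ← Real.sqrt_mul hT0.le, ← mul_assoc, ← mul_assoc]
    at htrade
  rw [sub_le_iff_le_add]
  refine Finset.sup'_le _ _ fun j _ => ?_
  have hreward := exp3ExpReward_ge hγ0 hγ1 (u := u) j T 0 (by simpa using hu)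
    (q := fun _ => 1) (fun _ => one_pos)
  have hpot : exp3Potential γ K j (fun _ => 1) = -((1 - γ) * (K * Real.log K / γ)) := by
    simp [exp3Potential]
    ring
  have hgain : ∑ t ∈ Finset.range T, u t j ≤ T := by
    simpa using Finset.sum_le_sum fun t (ht : t ∈ Finset.range T) =>
      (hu t (Finset.mem_range.1 ht) j).2
  simp only [hpot, zero_add] at hreward
  linarith [mul_le_mul_of_nonneg_left hgain hγ0.le]
end
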